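/- Under condition (A2), for every r > 0 and every compact set C ⊂ ℝ², uniformly over (ζ_1, ζ_2) ∈ C, E| (log X_1 − log b(n/k) + ζ_1/√k)_+ − (log X_1 − log b(n/k) + ζ_2/√k)_+ |^r ≤ |(ζ_1 − ζ_2)/√k|^r · (k/n) · (1 + O(1/√k)) as n → ∞. -/

import Mathlib

open MeasureTheory ProbabilityTheory Filter Set
open scoped ProbabilityTheory

noncomputable section

namespace TailCusum

variable {Ω : Type*} [MeasureSpace Ω]

/-- `φ₁(x) = 1{x > 0}`. -/
def phi1 (x : ℝ) : ℝ := if 0 < x then 1 else 0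

/-- `φ₂(x) = x₊ = max {x, 0}`. -/
def phi2 (x : ℝ) : ℝ := max x 0

/-- positive part -/
def pos (x : ℝ) : ℝ := max x 0

/-- A positive measurable function `g` is regularly varying at `∞` with index `ρ` if
`g(λ x)/g(x) → λ^ρ` as `x → ∞` for every `λ > 0`. -/
def RegularlyVarying (g : ℝ → ℝ) (ρ : ℝ) : Prop :=
  Measurable g ∧ ∀ lam : ℝ, 0 < lam →
    Tendsto (fun x => g (lam * x) / g x) atTop (nhds (lam ^ ρ))

/-- `l` is slowly varying at `∞`. -/
def SlowlyVarying (l : ℝ → ℝ) : Prop :=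
  Measurable l ∧ ∀ lam : ℝ, 0 < lam →
    Tendsto (fun x => l (lam * x) / l x) atTop (nhds 1)

/-- `κ(λ) = K ∫_1^λ t^(γ-1) dt`. -/
def kappaFun (K γ : ℝ) (lam : ℝ) : ℝ := K * ∫ t in (1:ℝ)..lam, t ^ (γ - 1)

/-- Second-order regular variation condition on the slowly varying function `l`
(the core of condition (A2)): `(l(λx)/l(x) - 1)/g(x) → κ(λ)` with
`κ(λ) = K ∫_1^λ t^(γ-1) dt`, `g` positive and regularly varying with index `γ ≤ 0`. -/
def SecondOrderRV (l g : ℝ → ℝ) (K γ : ℝ) : Prop :=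
  γ ≤ 0 ∧ (∀ x, 0 < g x) ∧ RegularlyVarying g γ ∧
  ∀ lam : ℝ, 0 < lam →
    Tendsto (fun x => (l (lam * x) / l x - 1) / g x) atTop (nhds (kappaFun K γ lam))

/-- distribution function of a law on `ℝ` -/
def df (μ : Measure ℝ) (x : ℝ) : ℝ := (μ (Iic x)).toReal

/-- tail distribution function `F̄(x) = μ(x, ∞)` -/
def tailDF (μ : Measure ℝ) (x : ℝ) : ℝ := (μ (Ioi x)).toReal

/-- the quantile-type function `b(x) = inf {y : F(y) ≥ 1 - x⁻¹}` -/
def quantileB (μ : Measure ℝ) (x : ℝ) : ℝ := sInf {y : ℝ | 1 - x⁻¹ ≤ df μ y}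

/-- `F̄(x) = x^(-α) l(x)` for `x > 0` with `l` slowly varying: Pareto-type tail. -/
def ParetoTail (μ : Measure ℝ) (α : ℝ) (l : ℝ → ℝ) : Prop :=
  SlowlyVarying l ∧ ∀ x : ℝ, 0 < x → tailDF μ x = x ^ (-α) * l x

/-- strict stationarity of a sequence of random variables -/
def IsStationary (X : ℕ → Ω → ℝ) : Prop :=
  ∀ j : ℕ,
    Measure.map (fun ω => fun i : ℕ => X (i + j) ω) (ℙ : Measure Ω)
      = Measure.map (fun ω => fun i : ℕ => X i ω) (ℙ : Measure Ω)

/-- strict stationarity, `ℤ`-indexed -/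
def IsStationaryZ (X : ℤ → Ω → ℝ) : Prop :=
  ∀ j : ℤ,
    Measure.map (fun ω => fun i : ℤ => X (i + j) ω) (ℙ : Measure Ω)
      = Measure.map (fun ω => fun i : ℤ => X i ω) (ℙ : Measure Ω)

/-- The β-mixing coefficient of the sequence `X` at lag `lag`, expressed as
the supremum over `m` of the total-variation distance between the joint law of
`(X_1, …, X_m)` and `(X_{m+lag+1}, X_{m+lag+2}, …)` and the product of the two laws. -/
def betaMix (X : ℕ → Ω → ℝ) (lag : ℕ) : ℝ :=
  ⨆ m : ℕ, ⨆ S : Subtype (MeasurableSet : Set ((Fin m → ℝ) × (ℕ → ℝ)) → Prop),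
    |((Measure.map
        (fun ω => ((fun i : Fin m => X ((i : ℕ) + 1) ω, fun i : ℕ => X (m + lag + 1 + i) ω)))
        (ℙ : Measure Ω)) S.1).toReal
      - (((Measure.map (fun ω => fun i : Fin m => X ((i : ℕ) + 1) ω) (ℙ : Measure Ω)).prod
          (Measure.map (fun ω => fun i : ℕ => X (m + lag + 1 + i) ω) (ℙ : Measure Ω))) S.1).toReal|

/-- The tail sample fraction condition: `k → ∞` and `k = o(n)`. -/
def TailFraction (k : ℕ → ℕ) : Prop :=
  Tendsto (fun n : ℕ => (k n : ℝ)) atTop atTop ∧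
    Tendsto (fun n : ℕ => (k n : ℝ) / n) atTop (nhds 0)

/-- Condition (A1): `(n / r_n) β([ε r_n]) → 0` for every `ε > 0`, and `r_n² = o(k)`. -/
def CondA1 (X : ℕ → Ω → ℝ) (k r : ℕ → ℕ) : Prop :=
  (∀ n, 0 < r n) ∧
  (∀ ε : ℝ, 0 < ε →
    Tendsto (fun n : ℕ => ((n : ℝ) / r n) * betaMix X ⌊ε * r n⌋₊) atTop (nhds 0)) ∧
  Tendsto (fun n : ℕ => ((r n : ℝ) ^ 2 / k n)) atTop (nhds 0)

/-- Condition (A2): second-order regular variation of `l` plus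
`√k · g(b(n/k)) → A ∈ ℝ`. -/
def CondA2 (l g : ℝ → ℝ) (K γ A : ℝ) (b : ℝ → ℝ) (k : ℕ → ℕ) : Prop :=
  SecondOrderRV l g K γ ∧
    Tendsto (fun n : ℕ => Real.sqrt (k n) * g (b ((n : ℝ) / k n))) atTop (nhds A)

/-- covariance of two real random variables -/
def cov (f g : Ω → ℝ) : ℝ :=
  ∫ ω, (f ω - ∫ ω', f ω') * (g ω - ∫ ω', g ω')

/-- pairs `1 ≤ i < j ≤ N` -/
def pairsUpTo (N : ℕ) : Finset (ℕ × ℕ) :=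
  ((Finset.Icc 1 N) ×ˢ (Finset.Icc 1 N)).filter fun p => p.1 < p.2

/-- Condition (A3): existence of the limits `χ` and `ω` of the normalized sums of
covariances, for every `0 < ε < 1`. -/
def CondA3 (X : ℕ → Ω → ℝ) (b : ℝ → ℝ) (k r : ℕ → ℕ) (α χ ωc : ℝ) : Prop :=
  0 ≤ χ ∧ 0 ≤ ωc ∧
  ∀ ε : ℝ, 0 < ε → ε < 1 →
    (Tendsto (fun n : ℕ =>
        (2 * α ^ 2 * n / ((⌊ε * r n⌋₊ : ℝ) * k n)) *
          ∑ p ∈ pairsUpTo ⌊ε * r n⌋₊,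
            cov (fun ω => pos (Real.log (X p.1 ω) - Real.log (b ((n : ℝ) / k n))))
                (fun ω => pos (Real.log (X p.2 ω) - Real.log (b ((n : ℝ) / k n)))))
      atTop (nhds χ)) ∧
    (Tendsto (fun n : ℕ =>
        (2 * (n : ℝ) / ((⌊ε * r n⌋₊ : ℝ) * k n)) *
          ∑ p ∈ pairsUpTo ⌊ε * r n⌋₊,
            cov (fun ω => if b ((n : ℝ) / k n) < X p.1 ω then (1 : ℝ) else 0)
                (fun ω => if b ((n : ℝ) / k n) < X p.2 ω then (1 : ℝ) else 0))
      atTop (nhds ωc))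

/-- the `k`-th largest value among `X_1, …, X_n` -/
def orderStat (n k : ℕ) (X : ℕ → Ω → ℝ) (ω : Ω) : ℝ :=
  sInf {x : ℝ | ((Finset.Icc 1 n).filter fun i => x < X i ω).card < k}

/-- `|Σ_{i=1}^l Y_i - (l/n) Σ_{i=1}^n Y_i|` -/
def cusumAt (n : ℕ) (Y : ℕ → ℝ) (l : ℕ) : ℝ :=
  |∑ i ∈ Finset.Icc 1 l, Y i - ((l : ℝ) / n) * ∑ i ∈ Finset.Icc 1 n, Y i|

/-- The cusum statistic `T_n(φ)` with random threshold `X_(k)`. -/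
def cusum (n k : ℕ) (X : ℕ → Ω → ℝ) (φ : ℝ → ℝ) (ω : Ω) : ℝ :=
  (Real.sqrt k)⁻¹ *
    ⨆ l ∈ Finset.Icc 1 n,
      cusumAt n (fun i => φ (Real.log (X i ω) - Real.log (orderStat n k X ω))) l

/-- The cusum statistic with deterministic threshold `b(n/k)`. -/
def cusumDet (n k : ℕ) (X : ℕ → Ω → ℝ) (φ : ℝ → ℝ) (b : ℝ → ℝ) (ω : Ω) : ℝ :=
  (Real.sqrt k)⁻¹ *
    ⨆ l ∈ Finset.Icc 1 n,
      cusumAt n (fun i => φ (Real.log (X i ω) - Real.log (b ((n : ℝ) / k)))) l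

/-- convergence in distribution (weak convergence of laws) of real random variables to
a real random variable `Z` defined on a possibly different probability space -/
def TendstoInDist {Ω' : Type*} [MeasureSpace Ω'] (Y : ℕ → Ω → ℝ) (Z : Ω' → ℝ) : Prop :=
  ∀ f : ℝ → ℝ, Continuous f → (∃ C, ∀ x, |f x| ≤ C) →
    Tendsto (fun n : ℕ => ∫ ω, f (Y n ω)) atTop (nhds (∫ ω, f (Z ω)))

/-- convergence in distribution to a law `μ` on `ℝ` -/
def TendstoInLaw (Y : ℕ → Ω → ℝ) (μ : Measure ℝ) : Prop :=
  ∀ f : ℝ → ℝ, Continuous f → (∃ C, ∀ x, |f x| ≤ C) →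
    Tendsto (fun n : ℕ => ∫ ω, f (Y n ω)) atTop (nhds (∫ x, f x ∂μ))

/-- bounded in probability (`O_P(1)`) -/
def BddInProb (Y : ℕ → Ω → ℝ) : Prop :=
  ∀ ε : ℝ, 0 < ε → ∃ C : ℝ, ∀ᶠ n in atTop,
    ((ℙ : Measure Ω) {ω | C < |Y n ω|}).toReal < ε

/-- divergence to `+∞` in probability -/
def DivergesInProb (Y : ℕ → Ω → ℝ) : Prop :=
  ∀ C : ℝ, Tendsto (fun n : ℕ => ((ℙ : Measure Ω) {ω | Y n ω ≤ C}).toReal) atTop (nhds 0)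

/-- standard Brownian motion on `[0, ∞)` -/
structure IsStdBrownianMotion {Ω' : Type*} [MeasureSpace Ω'] (B : ℝ → Ω' → ℝ) : Prop where
  isProb : IsProbabilityMeasure (ℙ : Measure Ω')
  meas : ∀ t, Measurable (B t)
  start : ∀ᵐ ω ∂(ℙ : Measure Ω'), B 0 ω = 0
  gauss_incr : ∀ s t : ℝ, 0 ≤ s → s ≤ t →
    Measure.map (fun ω => B t ω - B s ω) (ℙ : Measure Ω')
      = gaussianReal 0 (Real.toNNReal (t - s))
  indep_incr : ∀ (n : ℕ) (ts : ℕ → ℝ), (∀ i, 0 ≤ ts i) → Monotone ts →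
    iIndepFun (m := fun _ => Real.measurableSpace)
      (fun i : Fin n => fun ω => B (ts ((i : ℕ) + 1)) ω - B (ts (i : ℕ)) ω)
      (ℙ : Measure Ω')

/-- `sup_{0 ≤ t ≤ 1} |B°(t)|` where `B°(t) = B(t) - t B(1)` is the Brownian bridge
associated with the Brownian motion `B` -/
def supAbsBrownianBridge {Ω' : Type*} [MeasureSpace Ω'] (B : ℝ → Ω' → ℝ) (ω : Ω') : ℝ :=
  ⨆ t : Icc (0 : ℝ) 1, |B (t : ℝ) ω - (t : ℝ) * B 1 ω|

/-- `A_i(ζ) = φ(log X_i - log b(n/k) + ζ/√k)` -/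
def An (X : ℕ → Ω → ℝ) (b : ℝ → ℝ) (φ : ℝ → ℝ) (n k : ℕ) (ζ : ℝ) (i : ℕ) (ω : Ω) : ℝ :=
  φ (Real.log (X i ω) - Real.log (b ((n : ℝ) / k)) + ζ / Real.sqrt k)

/-- the tail sequential process `M_n(t, ζ) = k^{-1/2} Σ_{i=1}^{[nt]} (A_i(ζ) - E A_1(ζ))` -/
def Mn (X : ℕ → Ω → ℝ) (b : ℝ → ℝ) (φ : ℝ → ℝ) (n k : ℕ) (t ζ : ℝ) (ω : Ω) : ℝ :=
  (Real.sqrt k)⁻¹ * ∑ i ∈ Finset.Icc 1 ⌊(n : ℝ) * t⌋₊,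
    (An X b φ n k ζ i ω - ∫ ω', An X b φ n k ζ 1 ω')

/-- residual `ξ̂_i = X_i - Σ_{j=1}^p φ̂_j X_{i-j}` of an AR(p) fit -/
def residual (p : ℕ) (X : ℤ → Ω → ℝ) (φh : Ω → Fin p → ℝ) (i : ℕ) (ω : Ω) : ℝ :=
  X i ω - ∑ j : Fin p, φh ω j * X ((i : ℤ) - ((j : ℕ) + 1)) ω

/-- absolute residual `Ẑ_i = |ξ̂_i|` -/
def Zhat (p : ℕ) (X : ℤ → Ω → ℝ) (φh : Ω → Fin p → ℝ) (i : ℕ) (ω : Ω) : ℝ :=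
  |residual p X φh i ω|

/-- stationarity of the restriction of `Y` to the segment of indices `[a, b]` -/
def SegStationary (a b : ℕ) (Y : ℕ → Ω → ℝ) : Prop :=
  ∀ (m : ℕ) (s : Fin m → ℕ) (j : ℕ), (∀ q, a ≤ s q ∧ s q + j ≤ b) →
    Measure.map (fun ω => fun q : Fin m => Y (s q + j) ω) (ℙ : Measure Ω)
      = Measure.map (fun ω => fun q : Fin m => Y (s q) ω) (ℙ : Measure Ω)

/-- the row-wise mixing coefficient
`β_n(l) = sup_m sup {|P(A∩B) - P(A)P(B)| : A ∈ σ(Y_i : m+l+1 ≤ i ≤ n), B ∈ σ(Y_1,…,Y_m)}` -/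
def betaMixRow (n : ℕ) (Y : ℕ → Ω → ℝ) (lag : ℕ) : ℝ :=
  ⨆ m : ℕ, ⨆ As : Subtype (MeasurableSet : Set (Fin (n - (m + lag)) → ℝ) → Prop),
    ⨆ Bs : Subtype (MeasurableSet : Set (Fin m → ℝ) → Prop),
      |((ℙ : Measure Ω)
          (((fun ω => fun i : Fin (n - (m + lag)) => Y (m + lag + 1 + (i : ℕ)) ω) ⁻¹' As.1)
            ∩ ((fun ω => fun i : Fin m => Y ((i : ℕ) + 1) ω) ⁻¹' Bs.1))).toReal
        - ((ℙ : Measure Ω)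
            ((fun ω => fun i : Fin (n - (m + lag)) => Y (m + lag + 1 + (i : ℕ)) ω) ⁻¹' As.1)).toReal
          * ((ℙ : Measure Ω)
            ((fun ω => fun i : Fin m => Y ((i : ℕ) + 1) ω) ⁻¹' Bs.1)).toReal|

/-- If `H` has increments of order `G` pointwise at infinity, then along any sequence tending to
infinity the bound is uniform on a large part of the unit interval. -/
theorem exists_measure_increment_bound {H G : ℝ → ℝ} (hH : Measurable H)
    (hG : ∀ x, 0 ≤ G x)
    (hHG : ∀ v, ∃ C : ℝ, ∀ᶠ x in atTop, |H (x + v) - H x| ≤ C * G x)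
    {x : ℕ → ℝ} (hx : Tendsto x atTop atTop) :
    ∃ N : ℕ, ∃ S ⊆ Icc (0 : ℝ) 1, MeasurableSet S ∧ ENNReal.ofReal (3 / 4) < volume S ∧
      ∀ v ∈ S, ∀ n ≥ N, |H (x n + v) - H (x n)| ≤ N * G (x n) := by
  let S : ℕ → Set ℝ := fun N =>
    Icc 0 1 ∩ ⋂ n : ℕ, ⋂ _ : N ≤ n, {v | |H (x n + v) - H (x n)| ≤ N * G (x n)}
  have hmem : ∀ N v, v ∈ S N ↔ v ∈ Icc (0 : ℝ) 1 ∧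
      ∀ n ≥ N, |H (x n + v) - H (x n)| ≤ N * G (x n) := by
    intro N v
    simp [S]
  have hS_meas : ∀ N, MeasurableSet (S N) := by
    intro N
    refine measurableSet_Icc.inter (MeasurableSet.iInter fun n => MeasurableSet.iInter fun _ => ?_)
    refine measurableSet_le ?_ measurable_const
    fun_prop
  have hmono : Monotone S := by
    intro M N hMN v hv
    rw [hmem] at hv ⊢
    refine ⟨hv.1, fun n hn => (hv.2 n (hMN.trans hn)).trans ?_⟩
    exact mul_le_mul_of_nonneg_right (by exact_mod_cast hMN) (hG _)
  have hunion : ⋃ N, S N = Icc 0 1 := by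
    refine Subset.antisymm (iUnion_subset fun N v hv => hv.1) fun v hv => ?_
    obtain ⟨C, hC⟩ := hHG v
    obtain ⟨N, hN⟩ := eventually_atTop.1 (hx.eventually hC)
    refine mem_iUnion.2 ⟨max N ⌈C⌉₊, (hmem _ _).2 ⟨hv, fun n hn => ?_⟩⟩
    refine (hN n ((le_max_left _ _).trans hn)).trans (mul_le_mul_of_nonneg_right ?_ (hG _))
    exact (Nat.le_ceil C).trans (by exact_mod_cast le_max_right _ _)
  have htend := tendsto_measure_iUnion_atTop (μ := (volume : Measure ℝ)) hmono
  rw [hunion, Real.volume_Icc] at htend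
  have hlt : ENNReal.ofReal (3 / 4) < ENNReal.ofReal (1 - 0) :=
    (ENNReal.ofReal_lt_ofReal_iff (by norm_num)).2 (by norm_num)
  obtain ⟨N, hN⟩ := (htend.eventually (lt_mem_nhds hlt)).exists
  exact ⟨N, S N, inter_subset_left, hS_meas N, hN, fun v hv => ((hmem N v).1 hv).2⟩

/-- A uniform boundedness theorem: pointwise bounds on the increments of a measurable function
at infinity hold along vanishing shifts. -/
theorem exists_eventually_increment_bound {H G : ℝ → ℝ} (hH : Measurable H)
    (hG : ∀ x, 0 ≤ G x)
    (hHG : ∀ v, ∃ C : ℝ, ∀ᶠ x in atTop, |H (x + v) - H x| ≤ C * G x)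
    {x u : ℕ → ℝ} (hx : Tendsto x atTop atTop) (hu : Tendsto u atTop (nhds 0)) :
    ∃ C : ℝ, 0 ≤ C ∧
      ∀ᶠ n in atTop, |H (x n + u n) - H (x n)| ≤ C * (G (x n) + G (x n + u n)) := by
  obtain ⟨M, S, hS, -, hSvol, hSbound⟩ := exists_measure_increment_bound hH hG hHG hx
  obtain ⟨N, T, hT, hTmeas, hTvol, hTbound⟩ :=
    exists_measure_increment_bound hH hG hHG (hx.atTop_add hu)
  refine ⟨max M N, by positivity, ?_⟩
  have hu' : ∀ᶠ n in atTop, u n ∈ Ioo (-(1 / 4) : ℝ) (1 / 4) :=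
    hu.eventually (Ioo_mem_nhds (by norm_num) (by norm_num))
  filter_upwards [hu', eventually_ge_atTop M, eventually_ge_atTop N] with n hun hM hN
  obtain ⟨v, hvS, hvT⟩ : (S ∩ (fun v => v + -u n) ⁻¹' T).Nonempty := by
    refine nonempty_inter_of_measure_lt_add (u := Icc (-(1 / 4)) (5 / 4)) volume
      (hTmeas.preimage (by fun_prop)) ?_ ?_ ?_
    · exact hS.trans (Icc_subset_Icc (by norm_num) (by norm_num))
    · intro v hv
      have := hT hv
      simp only [mem_Icc, mem_Ioo] at this hun ⊢
      constructor <;> linarith [this.1, this.2, hun.1, hun.2]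
    · rw [measure_preimage_add_right, Real.volume_Icc]
      calc ENNReal.ofReal (5 / 4 - -(1 / 4))
          = ENNReal.ofReal (3 / 4) + ENNReal.ofReal (3 / 4) := by
            rw [← ENNReal.ofReal_add (by norm_num) (by norm_num)]
            norm_num
        _ < volume S + volume T := ENNReal.add_lt_add hSvol hTvol
  have h₁ := hSbound v hvS n hM
  have h₂ := hTbound _ hvT n hN
  rw [show x n + u n + (v + -u n) = x n + v by ring] at h₂
  have h₃ : (M : ℝ) * G (x n) ≤ max (M : ℝ) N * G (x n) :=
    mul_le_mul_of_nonneg_right (le_max_left _ _) (hG _)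
  have h₄ : (N : ℝ) * G (x n + u n) ≤ max (M : ℝ) N * G (x n + u n) :=
    mul_le_mul_of_nonneg_right (le_max_right _ _) (hG _)
  rw [abs_le] at *
  constructor <;> linarith [h₁.1, h₁.2, h₂.1, h₂.2]

/-- A positive regularly varying function changes by at most a bounded factor under
asymptotically negligible rescaling. -/
theorem RegularlyVarying.exists_eventually_le_mul {g : ℝ → ℝ} {γ : ℝ}
    (hg : RegularlyVarying g γ) (hpos : ∀ x, 0 < g x) {x u : ℕ → ℝ}
    (hx : Tendsto x atTop atTop) (hu : Tendsto u atTop (nhds 0)) :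
    ∃ C : ℝ, ∀ᶠ n in atTop, g (Real.exp (x n + u n)) ≤ C * g (Real.exp (x n)) := by
  have hmeas : Measurable fun y => Real.log (g (Real.exp y)) :=
    Real.measurable_log.comp (hg.1.comp Real.measurable_exp)
  obtain ⟨C, -, hC⟩ := exists_eventually_increment_bound hmeas (G := fun _ => 1)
    (fun _ => zero_le_one) (fun v => by
      have h := (hg.2 (Real.exp v) (Real.exp_pos v)).comp Real.tendsto_exp_atTop
      have h' := ((Real.continuousAt_log
        (Real.rpow_pos_of_pos (Real.exp_pos v) γ).ne').tendsto.comp h).abs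
      refine ⟨|Real.log (Real.exp v ^ γ)| + 1, ?_⟩
      filter_upwards [h'.eventually (gt_mem_nhds (lt_add_one _))] with y hy
      rw [mul_one]
      refine le_of_eq_of_le ?_ hy.le
      simp only [Function.comp_apply]
      rw [Real.log_div (hpos _).ne' (hpos _).ne', ← Real.exp_add, add_comm v y]) hx hu
  refine ⟨Real.exp (C * (1 + 1)), ?_⟩
  filter_upwards [hC] with n hn
  have := (abs_le.1 hn).2
  rw [← Real.log_le_log_iff (hpos _) (mul_pos (Real.exp_pos _) (hpos _)),
    Real.log_mul (Real.exp_pos _).ne' (hpos _).ne', Real.log_exp]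
  linarith

theorem SlowlyVarying.eventually_ne_zero {l : ℝ → ℝ} (hl : SlowlyVarying l) :
    ∀ᶠ x in atTop, l x ≠ 0 := by
  filter_upwards [(hl.2 1 one_pos).eventually_ne one_ne_zero] with x hx h
  simp [h] at hx

/-- Second-order regular variation controls the logarithmic increments of `l` under
asymptotically negligible rescaling. -/
theorem SecondOrderRV.exists_eventually_abs_log_sub_le {l g : ℝ → ℝ} {K γ : ℝ}
    (h : SecondOrderRV l g K γ) (hl : SlowlyVarying l) {x u : ℕ → ℝ}
    (hx : Tendsto x atTop atTop) (hu : Tendsto u atTop (nhds 0)) :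
    ∃ C : ℝ, ∀ᶠ n in atTop,
      |Real.log (l (Real.exp (x n + u n))) - Real.log (l (Real.exp (x n)))|
        ≤ C * g (Real.exp (x n)) := by
  obtain ⟨-, hgpos, hg, hlim⟩ := h
  have hmeas : Measurable fun y => Real.log (l (Real.exp y)) :=
    Real.measurable_log.comp (hl.1.comp Real.measurable_exp)
  have hne : ∀ᶠ y in atTop, l (Real.exp y) ≠ 0 :=
    Real.tendsto_exp_atTop.eventually hl.eventually_ne_zero
  obtain ⟨C, hC0, hC⟩ := exists_eventually_increment_bound hmeas (G := fun y => g (Real.exp y))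
    (fun y => (hgpos _).le) (fun v => by
      have h₁ := (hl.2 (Real.exp v) (Real.exp_pos v)).comp Real.tendsto_exp_atTop
      have h₂ := ((hlim (Real.exp v) (Real.exp_pos v)).comp Real.tendsto_exp_atTop).abs
      refine ⟨2 * (|kappaFun K γ (Real.exp v)| + 1), ?_⟩
      filter_upwards [h₁.eventually (lt_mem_nhds (by norm_num : (1 / 2 : ℝ) < 1)),
        h₂.eventually (gt_mem_nhds (lt_add_one _)), hne,
        (tendsto_atTop_add_const_right atTop v tendsto_id).eventually hne] with y hy₁ hy₂ hy₃ hy₄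
      simp only [Function.comp_apply, ← Real.exp_add, add_comm v y, id] at hy₁ hy₂ hy₄
      rw [← Real.log_div hy₄ hy₃]
      set q := l (Real.exp (y + v)) / l (Real.exp y)
      rw [abs_div, abs_of_pos (hgpos _), div_lt_iff₀ (hgpos _)] at hy₂
      have hq : 0 < q := by linarith
      have hup := Real.log_le_sub_one_of_pos hq
      have hlo := Real.one_sub_inv_le_log_of_pos hq
      have hlog : |Real.log q| ≤ 2 * |q - 1| := by
        have h₃ : 1 - q⁻¹ = (q - 1) / q := by field_simp
        have h₄ : |(q - 1) / q| ≤ 2 * |q - 1| := by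
          rw [abs_div, abs_of_pos hq, div_le_iff₀ hq]
          nlinarith [abs_nonneg (q - 1)]
        rw [h₃] at hlo
        refine abs_le.2 ⟨by linarith [(abs_le.1 h₄).1], ?_⟩
        linarith [le_abs_self (q - 1), abs_nonneg (q - 1)]
      linarith) hx hu
  obtain ⟨D, hD⟩ := hg.exists_eventually_le_mul hgpos hx hu
  refine ⟨C * (1 + D), ?_⟩
  filter_upwards [hC, hD] with n hn hn'
  refine hn.trans ?_
  rw [mul_assoc]
  exact mul_le_mul_of_nonneg_left (by linarith) hC0

theorem TailFraction.tendsto_div_atTop {k : ℕ → ℕ} (hk : TailFraction k) :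
    Tendsto (fun n : ℕ => (n : ℝ) / k n) atTop atTop := by
  have h0 : Tendsto (fun n : ℕ => (k n : ℝ) / n) atTop (nhdsWithin 0 (Ioi 0)) := by
    refine tendsto_nhdsWithin_iff.2 ⟨hk.2, ?_⟩
    filter_upwards [hk.1.eventually_gt_atTop 0, eventually_gt_atTop 0] with n hn hn'
    exact div_pos hn (by exact_mod_cast hn')
  exact h0.inv_tendsto_nhdsGT_zero.congr fun n => by simp

section Quantile

variable {μ : Measure ℝ} [IsProbabilityMeasure μ]

theorem tailDF_eq_one_sub_df (x : ℝ) : tailDF μ x = 1 - df μ x := by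
  rw [tailDF, df, ← compl_Iic]
  exact probReal_compl_eq_one_sub measurableSet_Iic

theorem tailDF_antitone : Antitone (tailDF μ) := fun _ _ h =>
  measureReal_mono (Ioi_subset_Ioi h)

theorem df_eq_cdf : df μ = cdf μ := by
  ext x
  exact (cdf_eq_real μ x).symm

theorem ParetoTail.tailDF_pos {α : ℝ} {l : ℝ → ℝ} (h : ParetoTail μ α l) (x : ℝ) :
    0 < tailDF μ x := by
  obtain ⟨y, hly, hy, hxy⟩ := (h.1.eventually_ne_zero.and
    ((eventually_gt_atTop 0).and (eventually_ge_atTop x))).exists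
  refine lt_of_lt_of_le ?_ (tailDF_antitone hxy)
  refine lt_of_le_of_ne ENNReal.toReal_nonneg (Ne.symm ?_)
  rw [h.2 y hy]
  exact mul_ne_zero (Real.rpow_pos_of_pos hy _).ne' hly

theorem nonempty_le_df {c : ℝ} (hc : c < 1) : {y | c ≤ df μ y}.Nonempty := by
  rw [df_eq_cdf]
  obtain ⟨y, hy⟩ := ((tendsto_cdf_atTop μ).eventually (lt_mem_nhds hc)).exists
  exact ⟨y, hy.le⟩

theorem bddBelow_le_df {c : ℝ} (hc : 0 < c) : BddBelow {y | c ≤ df μ y} := by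
  rw [df_eq_cdf]
  obtain ⟨y, hy⟩ := ((tendsto_cdf_atBot μ).eventually (gt_mem_nhds hc)).exists
  refine ⟨y, fun z hz => le_of_lt ?_⟩
  by_contra! hzy
  exact (hz.trans (monotone_cdf μ hzy)).not_gt hy

theorem tailDF_quantileB_le {t : ℝ} (ht : 1 < t) : tailDF μ (quantileB μ t) ≤ t⁻¹ := by
  have hne := nonempty_le_df (μ := μ) (c := 1 - t⁻¹) (by linarith [inv_pos.2 (one_pos.trans ht)])
  have hlim : Tendsto (cdf μ) (nhdsWithin (quantileB μ t) (Ioi (quantileB μ t)))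
      (nhds (cdf μ (quantileB μ t))) :=
    ((cdf μ).right_continuous _).mono_left (nhdsWithin_mono _ Ioi_subset_Ici_self)
  have hle : 1 - t⁻¹ ≤ cdf μ (quantileB μ t) := by
    refine ge_of_tendsto hlim (eventually_nhdsWithin_of_forall fun y hy => ?_)
    obtain ⟨z, hz, hzy⟩ := exists_lt_of_csInf_lt hne hy
    rw [df_eq_cdf] at hz
    exact hz.trans (monotone_cdf μ hzy.le)
  rw [tailDF_eq_one_sub_df, df_eq_cdf]
  linarith

theorem tendsto_quantileB_atTop (hpos : ∀ x, 0 < tailDF μ x) :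
    Tendsto (quantileB μ) atTop atTop := by
  refine tendsto_atTop.2 fun y => ?_
  filter_upwards [eventually_gt_atTop 1,
    tendsto_inv_atTop_zero.eventually (gt_mem_nhds (hpos y))] with t ht hty
  refine le_csInf (nonempty_le_df (by linarith [inv_pos.2 (one_pos.trans ht)])) fun z hz => ?_
  by_contra! hzy
  have h₁ := tailDF_antitone (μ := μ) hzy.le
  rw [tailDF_eq_one_sub_df z] at h₁
  have : 1 - t⁻¹ ≤ df μ z := hz
  linarith

/-- A shift of order `1 / √k` of the logarithmic threshold perturbs the exceedance probability
`k / n` by a factor `1 + O(1 / √k)`. -/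
theorem exists_eventually_tailDF_shift_le {α : ℝ} {l g : ℝ → ℝ} {K γ A : ℝ} {k : ℕ → ℕ}
    (hF : ParetoTail μ α l) (hk : TailFraction k) (hA2 : CondA2 l g K γ A (quantileB μ) k)
    (M : ℝ) :
    ∃ C : ℝ, 0 ≤ C ∧ ∀ᶠ n : ℕ in atTop,
      tailDF μ (Real.exp (Real.log (quantileB μ ((n : ℝ) / k n)) - M / Real.sqrt (k n)))
        ≤ ((k n : ℝ) / n) * (1 + C / Real.sqrt (k n)) := by
  have hs : Tendsto (fun n => Real.sqrt (k n)) atTop atTop := Real.tendsto_sqrt_atTop.comp hk.1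
  have hratio := hk.tendsto_div_atTop
  have hb := (tendsto_quantileB_atTop hF.tailDF_pos).comp hratio
  have hx := Real.tendsto_log_atTop.comp hb
  have hu : Tendsto (fun n => -M / Real.sqrt (k n)) atTop (nhds 0) := hs.const_div_atTop _
  obtain ⟨C, hC⟩ := hA2.1.exists_eventually_abs_log_sub_le hF.1 hx hu
  set E : ℝ := |α * M| + |C| * (|A| + 1)
  have hE : 0 ≤ E := by positivity
  refine ⟨2 * E, by positivity, ?_⟩
  filter_upwards [hC, hb.eventually_gt_atTop 0, hratio.eventually_gt_atTop 1,
    hs.eventually_gt_atTop 0, hs.eventually_ge_atTop E,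
    hA2.2.eventually (gt_mem_nhds ((le_abs_self A).trans_lt (lt_add_one _)))]
    with n hn hbn hrn hsn hsE hgn
  simp only [Function.comp_apply] at hn hbn
  set b := quantileB μ ((n : ℝ) / k n)
  set s := Real.sqrt (k n)
  rw [Real.exp_log hbn] at hn
  have hlpos : ∀ y, 0 < y → 0 < l y := fun y hy => by
    have := hF.tailDF_pos y
    rw [hF.2 y hy] at this
    exact pos_of_mul_pos_right this (Real.rpow_pos_of_pos hy _).le
  have htail : ∀ y, 0 < y →
      tailDF μ y = Real.exp (-α * Real.log y + Real.log (l y)) := fun y hy => by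
    rw [hF.2 y hy, Real.exp_add, Real.exp_log (hlpos y hy), Real.rpow_def_of_pos hy, mul_comm (-α)]
  have hbtail : tailDF μ b ≤ (k n : ℝ) / n := by
    simpa using tailDF_quantileB_le (μ := μ) hrn
  have hy : Real.log b + -M / s = Real.log b - M / s := by ring
  rw [hy] at hn
  have hCg : C * g b ≤ |C| * (|A| + 1) / s := by
    rw [le_div_iff₀ hsn]
    have hg0 := hA2.1.2.1 b
    calc C * g b * s ≤ |C| * (s * g b) := by
          nlinarith [mul_le_mul_of_nonneg_right (le_abs_self C) (mul_pos hsn hg0).le]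
      _ ≤ _ := mul_le_mul_of_nonneg_left hgn.le (abs_nonneg C)
  have hexp : Real.exp (E / s) ≤ 1 + 2 * E / s := by
    have h0 : 0 ≤ E / s := by positivity
    have h1 : |E / s| ≤ 1 := by rwa [abs_of_nonneg h0, div_le_one hsn]
    have := (abs_le.1 (Real.abs_exp_sub_one_le h1)).2
    rw [abs_of_nonneg h0] at this
    rw [mul_div_assoc]
    linarith
  have hαM : α * (M / s) ≤ |α * M| / s := by
    rw [← mul_div_assoc]
    exact div_le_div_of_nonneg_right (le_abs_self _) hsn.le
  have hEs : E / s = |α * M| / s + |C| * (|A| + 1) / s := add_div _ _ _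
  calc tailDF μ (Real.exp (Real.log b - M / s))
      ≤ tailDF μ b * Real.exp (E / s) := by
        rw [htail _ (Real.exp_pos _), htail b hbn, ← Real.exp_add, Real.exp_le_exp, Real.log_exp,
          hEs]
        linarith [(abs_le.1 hn).2]
    _ ≤ _ := mul_le_mul hbtail hexp (Real.exp_pos _).le (by positivity)

end Quantile

theorem abs_pos_sub_pos_rpow_le (y a b r m : ℝ) (hr : 0 < r) (ha : a ≤ m) (hb : b ≤ m) :
    |pos (y + a) - pos (y + b)| ^ r ≤ (Ioi (-m)).indicator (fun _ => |a - b| ^ r) y := by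
  by_cases hy : -m < y
  · rw [indicator_of_mem (mem_Ioi.2 hy)]
    refine Real.rpow_le_rpow (abs_nonneg _) ?_ hr.le
    simpa [pos] using abs_max_sub_max_le_abs (y + a) (y + b) 0
  · rw [indicator_of_notMem (notMem_Ioi.2 (not_lt.1 hy)), pos, pos, max_eq_right (by linarith), max_eq_right (by linarith)]
    simp [Real.zero_rpow hr.ne']

/-- Lemma 2, second part, of Kim–Lee (2009): moment bound for differences of shifted
positive parts, uniformly on compact `(ζ₁, ζ₂)`-sets. -/
theorem shifted_pos_part_moment_bound
    {Ω : Type*} [MeasureSpace Ω] [IsProbabilityMeasure (ℙ : Measure Ω)]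
    (X : Ω → ℝ) (hmeas : Measurable X) (hpos : ∀ ω, 0 ≤ X ω)
    (α : ℝ) (hα : 0 < α) (l : ℝ → ℝ)
    (hF : ParetoTail (Measure.map X (ℙ : Measure Ω)) α l)
    (k : ℕ → ℕ) (hk : TailFraction k)
    (g : ℝ → ℝ) (K γ A : ℝ)
    (hA2 : CondA2 l g K γ A (quantileB (Measure.map X (ℙ : Measure Ω))) k) :
    ∀ rexp : ℝ, 0 < rexp → ∀ C : Set (ℝ × ℝ), IsCompact C →
      ∃ C₀ : ℝ, 0 ≤ C₀ ∧ ∃ N : ℕ, ∀ n ≥ N, ∀ ζ ∈ C,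
        (∫ ω, |pos (Real.log (X ω)
              - Real.log (quantileB (Measure.map X (ℙ : Measure Ω)) ((n : ℝ) / k n))
              + ζ.1 / Real.sqrt (k n))
            - pos (Real.log (X ω)
              - Real.log (quantileB (Measure.map X (ℙ : Measure Ω)) ((n : ℝ) / k n))
              + ζ.2 / Real.sqrt (k n))| ^ rexp)
          ≤ |(ζ.1 - ζ.2) / Real.sqrt (k n)| ^ rexp * ((k n : ℝ) / n)
            * (1 + C₀ / Real.sqrt (k n)) := by
  intro r hr C hC
  have : IsProbabilityMeasure (Measure.map X (ℙ : Measure Ω)) :=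
    Measure.isProbabilityMeasure_map hmeas.aemeasurable
  set μ := Measure.map X (ℙ : Measure Ω)
  obtain ⟨M, hM⟩ := hC.isBounded.exists_norm_le
  obtain ⟨C₀, hC₀, hbound⟩ := exists_eventually_tailDF_shift_le hF hk hA2 M
  have hs : Tendsto (fun n => Real.sqrt (k n)) atTop atTop := Real.tendsto_sqrt_atTop.comp hk.1
  have hthreshold : ∀ᶠ n : ℕ in atTop,
      0 ≤ Real.log (quantileB μ ((n : ℝ) / k n)) - M / Real.sqrt (k n) := by
    have hlog := Real.tendsto_log_atTop.comp
      ((tendsto_quantileB_atTop hF.tailDF_pos).comp hk.tendsto_div_atTop)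
    filter_upwards [hlog.eventually_ge_atTop 1,
      (hs.const_div_atTop M).eventually (gt_mem_nhds one_pos)] with n h₁ h₂
    simp only [Function.comp_apply] at h₁
    linarith
  obtain ⟨N, hN⟩ := eventually_atTop.1
    (hbound.and (hthreshold.and (hs.eventually_gt_atTop 0)))
  refine ⟨C₀, hC₀, N, fun n hn ζ hζ => ?_⟩
  obtain ⟨htail, hlog, hsn⟩ := hN n hn
  set b := quantileB μ ((n : ℝ) / k n)
  set s := Real.sqrt (k n)
  have hζ₁ : ζ.1 / s ≤ M / s := div_le_div_of_nonneg_right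
    ((le_abs_self _).trans ((norm_fst_le ζ).trans (hM ζ hζ))) hsn.le
  have hζ₂ : ζ.2 / s ≤ M / s := div_le_div_of_nonneg_right
    ((le_abs_self _).trans ((norm_snd_le ζ).trans (hM ζ hζ))) hsn.le
  set c := |(ζ.1 - ζ.2) / s| ^ r
  have hc : 0 ≤ c := by positivity
  have hEmeas : MeasurableSet (X ⁻¹' Ioi (Real.exp (Real.log b - M / s))) :=
    hmeas measurableSet_Ioi
  have hdom : ∀ ω, |pos (Real.log (X ω) - Real.log b + ζ.1 / s)
      - pos (Real.log (X ω) - Real.log b + ζ.2 / s)| ^ r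
      ≤ (X ⁻¹' Ioi (Real.exp (Real.log b - M / s))).indicator (fun _ => c) ω := by
    intro ω
    refine (abs_pos_sub_pos_rpow_le _ _ _ r (M / s) hr hζ₁ hζ₂).trans ?_
    rw [← sub_div]
    refine indicator_apply_le' (fun hω => ?_) fun _ => indicator_nonneg (fun _ _ => hc) _
    rw [indicator_of_mem]
    have hω' : Real.log b - M / s < Real.log (X ω) := by
      rw [mem_Ioi] at hω
      linarith
    have hX : 0 < X ω := (hpos ω).lt_of_ne fun h => by
      rw [← h, Real.log_zero] at hω'
      linarith
    exact (Real.lt_log_iff_exp_lt hX).1 hω'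
  calc _ ≤ ∫ ω, (X ⁻¹' Ioi (Real.exp (Real.log b - M / s))).indicator (fun _ => c) ω :=
        integral_mono_of_nonneg (ae_of_all _ fun _ => by positivity)
          ((integrable_const c).indicator hEmeas) (ae_of_all _ hdom)
    _ = c * tailDF μ (Real.exp (Real.log b - M / s)) := by
        rw [integral_indicator_const _ hEmeas, smul_eq_mul, mul_comm, tailDF,
          Measure.map_apply hmeas measurableSet_Ioi, Measure.real]
    _ ≤ _ := by
        rw [mul_assoc]
        exact mul_le_mul_of_nonneg_left htail hc

end TailCusum
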